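/- Every positive definite form f of degree 4 in ℝ[x_1,x_2,x_3,x_4] (i.e. f(x) > 0 for all 0 ≠ x ∈ ℝ⁴) that lies in the boundary of the cone Σ_{4,4} (i.e. f ∈ Σ_{4,4} but f is not in the interior of Σ_{4,4} inside ℝ[x_1,x_2,x_3,x_4]_4) is a sum of four squares of quadratic forms. -/

import Mathlib

open MvPolynomial

noncomputable section

/-- `f` is a sum of `r` squares of forms of degree `d` in `n` variables. -/
def IsSOS (n d r : ℕ) (f : MvPolynomial (Fin n) ℝ) : Prop :=
  ∃ p : Fin r → MvPolynomial (Fin n) ℝ,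
    (∀ i, (p i).IsHomogeneous d) ∧ f = ∑ i, p i ^ 2

/-- `f` lies in `Σ_{n,2d}`: it is a sum of squares of forms of degree `d`. -/
def InSigma (n d : ℕ) (f : MvPolynomial (Fin n) ℝ) : Prop :=
  ∃ r, IsSOS n d r f

/-- The sum of squares length `ℓ(f)`. -/
def sosLength (n d : ℕ) (f : MvPolynomial (Fin n) ℝ) : ℕ :=
  sInf {r | IsSOS n d r f}

/-- The coefficientwise topology on polynomials; on each finite-dimensional
subspace of forms of fixed degree it induces the standard topology. -/
instance (n : ℕ) : TopologicalSpace (MvPolynomial (Fin n) ℝ) :=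
  TopologicalSpace.induced (fun f (m : Fin n →₀ ℕ) => MvPolynomial.coeff m f) inferInstance


/-- Simultaneous eigenvectors of commuting symmetric matrices. -/
lemma exists_joint_eigenvector {n : Type} [Fintype n] [DecidableEq n]
    (A : Fin 4 → Matrix n n ℝ) (hs : ∀ i, (A i).transpose = A i)
    (hc : ∀ i j, A i * A j = A j * A i) (k : n) :
    ∃ v : n → ℝ, ∃ y : Fin 4 → ℝ, v k = 1 ∧ ∀ i, (A i).mulVec v = y i • v := by
  classical
  let T : Fin 4 → (EuclideanSpace ℝ n →ₗ[ℝ] EuclideanSpace ℝ n) := fun i => Matrix.toEuclideanLin (A i)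
  have hT : ∀ i, (T i).IsSymmetric := fun i =>
    Matrix.isSymmetric_toEuclideanLin_iff.mpr (by
      rw [Matrix.IsHermitian, Matrix.conjTranspose_eq_transpose_of_trivial]; exact hs i)
  have hC : Pairwise (Function.onFun Commute T) := by
    intro i j _
    change T i * T j = T j * T i
    apply LinearMap.ext
    intro x
    simp only [Module.End.mul_apply, T, Matrix.toLpLin_apply, Matrix.mulVec_mulVec, hc i j]
  have hd := LinearMap.IsSymmetric.directSum_isInternal_of_pairwise_commute hT hC
  have hsup := hd.submodule_iSup_eq_top
  by_contra hcon
  push Not at hcon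
  have hle : (⨆ α : Fin 4 → ℝ, ⨅ j, Module.End.eigenspace (T j) (α j)) ≤
      LinearMap.ker (EuclideanSpace.proj k : EuclideanSpace ℝ n →L[ℝ] ℝ).toLinearMap := by
    apply iSup_le
    intro α x hx
    simp only [Submodule.mem_iInf, Module.End.mem_eigenspace_iff] at hx
    by_contra hne
    have hne' : x k ≠ 0 := hne
    obtain ⟨i, hi⟩ := hcon (fun l => (x k)⁻¹ * x l) α (by simp [hne'])
    apply hi
    have h1 : (A i).mulVec x.ofLp = α i • x.ofLp := by
      have := congrArg WithLp.ofLp (hx i)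
      simpa [T, Matrix.toLpLin_apply] using this
    have h2 : (fun l => (x k)⁻¹ * x l) = (x k)⁻¹ • x.ofLp := rfl
    rw [h2, Matrix.mulVec_smul, h1, smul_comm]
  rw [hsup] at hle
  have : EuclideanSpace.single k (1:ℝ) ∈ (⊤ : Submodule ℝ (EuclideanSpace ℝ n)) := trivial
  have := hle this
  simp at this

lemma exists_d_aux (l1 l2 l3 s a2 a3 b1 b3 c1 c2 : ℝ) (h1 : l1 ≠ 0) (h2 : l2 ≠ 0)
    (J11 : l1 * (l3 - l2) * s = 0) (J22 : l2 * (l1 - l3) * s = 0)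
    (J12 : l1 * (l3 - l2) * a2 + l2 * (l1 - l3) * b1 = 0)
    (J13 : l1 * (l3 - l2) * a3 + l3 * (l2 - l1) * c1 = 0)
    (J23 : l2 * (l1 - l3) * b3 + l3 * (l2 - l1) * c2 = 0) :
    ∃ d1 d2 d3 : ℝ, 
      (l2 - l1) * c1 = - d2 * l1 ∧ (l2 - l1) * c2 = d1 * l2 ∧ (l2 - l1) * s = 0 ∧
      (l3 - l2) * s = 0 ∧ (l3 - l2) * a2 = - d3 * l2 ∧ (l3 - l2) * a3 = d2 * l3 ∧
      (l3 - l1) * b1 = - d3 * l1 ∧ (l3 - l1) * s = 0 ∧ (l3 - l1) * b3 = d1 * l3 := by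
  have e1 : (l3 - l2) * s = 0 := by
    rw [mul_assoc] at J11; exact (mul_eq_zero.mp J11).resolve_left h1
  have e2 : (l1 - l3) * s = 0 := by
    rw [mul_assoc] at J22; exact (mul_eq_zero.mp J22).resolve_left h2
  refine ⟨(l2 - l1) * c2 / l2, -((l2 - l1) * c1 / l1), -((l3 - l2) * a2 / l2), ?_, ?_, ?_, e1, ?_, ?_, ?_, ?_, ?_⟩
  · field_simp
  · field_simp
  · linarith
  · field_simp
  · field_simp; linarith
  · field_simp; linarith
  · linarith
  · field_simp; linarith

set_option maxHeartbeats 800000 in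
/-- Existence of the diagonal corrections, symmetric version. -/
lemma exists_d (lam : Fin 4 → ℝ) (c : Fin 4 → Fin 4 → Fin 4 → ℝ)
    (h12 : ∀ i j k, c i j k = c j i k) (h23 : ∀ i j k, c i j k = c i k j)
    (M : Fin 4 → Matrix (Fin 4) (Fin 4) ℝ) (hM : ∀ i j k, M i j k = c i j k)
    (l0 : lam 0 = 0) (hc0 : ∀ j k, lam j * c 0 j k = lam j * (if j = k then 1 else 0))
    (hc0' : ∀ j k, j ≠ k → c 0 j k = 0)
    (hcomm : ∀ i j, M i * M j - M j * M i =
      Matrix.of fun k l => lam i * lam j * ((if j = k then 1 else 0) * (if i = l then 1 else 0)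
        - (if i = k then 1 else 0) * (if j = l then 1 else 0)))
    (hl : ∃ i j, i ≠ j ∧ lam i ≠ 0 ∧ lam j ≠ 0) :
    ∃ d : Fin 4 → ℝ, ∀ i j k, (lam j - lam i) * c i j k =
      d i * lam j * (if j = k then 1 else 0) - d j * lam i * (if i = k then 1 else 0) := by
  have hJ : ((M 1 * M 2 - M 2 * M 1) * M 3 - M 3 * (M 1 * M 2 - M 2 * M 1))
      + ((M 2 * M 3 - M 3 * M 2) * M 1 - M 1 * (M 2 * M 3 - M 3 * M 2))
      + ((M 3 * M 1 - M 1 * M 3) * M 2 - M 2 * (M 3 * M 1 - M 1 * M 3)) = 0 := by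
    noncomm_ring
  rw [hcomm, hcomm, hcomm] at hJ
  have J := fun k l => congrFun (congrFun hJ k) l
  have J11 := J 1 1
  have J22 := J 2 2
  have J33 := J 3 3
  have J12 := J 1 2
  have J13 := J 1 3
  have J23 := J 2 3
  simp [Matrix.mul_apply, hM] at J11 J22 J33 J12 J13 J23
  clear J hJ
  -- normal forms of the coefficients
  have n1 : c 2 1 3 = c 1 2 3 := h12 _ _ _
  have n2 : c 1 3 2 = c 1 2 3 := h23 _ _ _
  have n3 : c 2 3 1 = c 1 2 3 := by rw [h23, h12]
  have n4 : c 3 1 2 = c 1 2 3 := by rw [h12, h23]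
  have n5 : c 3 2 1 = c 1 2 3 := by rw [h23, h12, h23]
  have m1 : c 1 2 1 = c 1 1 2 := h23 _ _ _
  have m2 : c 2 1 1 = c 1 1 2 := by rw [h12, h23]
  have m3 : c 1 3 1 = c 1 1 3 := h23 _ _ _
  have m4 : c 3 1 1 = c 1 1 3 := by rw [h12, h23]
  have m5 : c 2 1 2 = c 1 2 2 := h12 _ _ _
  have m6 : c 2 2 1 = c 1 2 2 := by rw [h23, h12]
  have m7 : c 2 3 2 = c 2 2 3 := h23 _ _ _
  have m8 : c 3 2 2 = c 2 2 3 := by rw [h12, h23]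
  have m9 : c 3 1 3 = c 1 3 3 := h12 _ _ _
  have m10 : c 3 3 1 = c 1 3 3 := by rw [h23, h12]
  have m11 : c 3 2 3 = c 2 3 3 := h12 _ _ _
  have m12 : c 3 3 2 = c 2 3 3 := by rw [h23, h12]
  simp only [n1, n2, n3, n4, n5, m2, m4, m6, m7, m8, m9, m11] at J11 J22 J33 J12 J13 J23
  have K11 : lam 1 * (lam 3 - lam 2) * c 1 2 3 = 0 := by linarith
  have K22 : lam 2 * (lam 1 - lam 3) * c 1 2 3 = 0 := by linarith
  have K33 : lam 3 * (lam 2 - lam 1) * c 1 2 3 = 0 := by linarith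
  have K12 : lam 1 * (lam 3 - lam 2) * c 2 2 3 + lam 2 * (lam 1 - lam 3) * c 1 1 3 = 0 := by linarith
  have K13 : lam 1 * (lam 3 - lam 2) * c 2 3 3 + lam 3 * (lam 2 - lam 1) * c 1 1 2 = 0 := by linarith
  have K23 : lam 2 * (lam 1 - lam 3) * c 1 3 3 + lam 3 * (lam 2 - lam 1) * c 1 2 2 = 0 := by linarith
  have key : ∃ d1 d2 d3 : ℝ, 
      (lam 2 - lam 1) * c 1 1 2 = - d2 * lam 1 ∧ (lam 2 - lam 1) * c 1 2 2 = d1 * lam 2 ∧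
      (lam 2 - lam 1) * c 1 2 3 = 0 ∧
      (lam 3 - lam 2) * c 1 2 3 = 0 ∧ (lam 3 - lam 2) * c 2 2 3 = - d3 * lam 2 ∧
      (lam 3 - lam 2) * c 2 3 3 = d2 * lam 3 ∧
      (lam 3 - lam 1) * c 1 1 3 = - d3 * lam 1 ∧ (lam 3 - lam 1) * c 1 2 3 = 0 ∧
      (lam 3 - lam 1) * c 1 3 3 = d1 * lam 3 := by
    have hcase : (lam 1 ≠ 0 ∧ lam 2 ≠ 0) ∨ (lam 1 ≠ 0 ∧ lam 3 ≠ 0) ∨ (lam 2 ≠ 0 ∧ lam 3 ≠ 0) := by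
      obtain ⟨i, j, hij, hi, hj⟩ := hl
      fin_cases i <;> fin_cases j <;> simp_all
    rcases hcase with ⟨p, q⟩ | ⟨p, q⟩ | ⟨p, q⟩
    · exact exists_d_aux _ _ _ _ _ _ _ _ _ _ p q K11 K22 K12 K13 K23
    · obtain ⟨d1, d3, d2, e⟩ := exists_d_aux (lam 1) (lam 3) (lam 2) (c 1 2 3) (c 2 3 3) (c 2 2 3) (c 1 1 2)
        (c 1 2 2) (c 1 1 3) (c 1 3 3) p q (by linarith) (by linarith) (by linarith) (by linarith) (by linarith)
      refine ⟨d1, d2, d3, ?_⟩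
      refine ⟨?_, ?_, ?_, ?_, ?_, ?_, ?_, ?_, ?_⟩ <;> linarith
    · obtain ⟨d2, d3, d1, e⟩ := exists_d_aux (lam 2) (lam 3) (lam 1) (c 1 2 3) (c 1 3 3) (c 1 1 3) (c 1 2 2)
        (c 1 1 2) (c 2 2 3) (c 2 3 3) p q (by linarith) (by linarith) (by linarith) (by linarith) (by linarith)
      refine ⟨d1, d2, d3, ?_⟩
      refine ⟨?_, ?_, ?_, ?_, ?_, ?_, ?_, ?_, ?_⟩ <;> linarith
  obtain ⟨d1, d2, d3, e⟩ := key
  have z12 : c 1 2 0 = 0 := by rw [h23, h12]; exact hc0' _ _ (by decide)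
  have z13 : c 1 3 0 = 0 := by rw [h23, h12]; exact hc0' _ _ (by decide)
  have z23 : c 2 3 0 = 0 := by rw [h23, h12]; exact hc0' _ _ (by decide)
  refine ⟨![1, d1, d2, d3], ?_⟩
  have hlt : ∀ i j k : Fin 4, i < j → (lam j - lam i) * c i j k =
      ![1, d1, d2, d3] i * lam j * (if j = k then 1 else 0) 
        - ![1, d1, d2, d3] j * lam i * (if i = k then 1 else 0) := by
    intro i j k hij
    by_cases hi : i = 0
    · subst hi
      simpa [l0] using hc0 j k
    fin_cases i <;> fin_cases j <;> first | (exact absurd rfl hi) | (exact absurd hij (by decide)) | skip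
    all_goals
      fin_cases k <;> simp [-mul_eq_zero, z12, z13, z23, n2, n3, m1, m3, m7] <;> linarith
  intro i j k
  rcases lt_trichotomy i j with h | h | h
  · exact hlt i j k h
  · subst h; ring
  · have e := hlt j i k h
    rw [h12 i j k]
    linear_combination -e

/-- The coordinate form of the main argument. -/
lemma core_coords {E : Type} [NormedAddCommGroup E] [InnerProductSpace ℝ E]
    (h : Fin 4 → E) (nu : E) (g : Fin 4 → Fin 4 → E) (lam : Fin 4 → ℝ)
    (gs : ∀ i j, g i j = g j i)
    (gg : ∀ i j k l, inner ℝ (g i j) (g k l) = inner ℝ (g i k) (g j l))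
    (g0 : ∀ j, g 0 j = h j)
    (hh : ∀ i j, i ≠ j → inner ℝ (h i) (h j) = 0)
    (h00 : inner ℝ (h 0) (h 0) = 1)
    (h1 : ∀ i, inner ℝ (h i) (h i) = 1 ∨ lam i = 0)
    (hx : ∀ x : E, x = ∑ i, inner ℝ (h i) x • h i + inner ℝ nu x • nu)
    (hnu : ∀ i j, inner ℝ nu (g i j) = if i = j then lam i else 0)
    (l0 : lam 0 = 0) :
    ∃ v : E, ∃ y : Fin 4 → ℝ, y 0 = 1 ∧ ∀ i j, inner ℝ (g i j) v = y i * y j := by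
  set c : Fin 4 → Fin 4 → Fin 4 → ℝ := fun i j k => inner ℝ (g i j) (h k) with hc
  have h12 : ∀ i j k, c i j k = c j i k := fun i j k => by simp only [hc, gs i j]
  have h23 : ∀ i j k, c i j k = c i k j := fun i j k => by
    simp only [hc, ← g0]
    rw [gs 0 k, gg, gs j 0]
  let M : Fin 4 → Matrix (Fin 4) (Fin 4) ℝ := fun i => Matrix.of fun j k => c i j k
  have hM : ∀ i j k, M i j k = c i j k := fun _ _ _ => rfl
  have hMt : ∀ i, (M i).transpose = M i := fun i => by
    ext j k; exact h23 _ _ _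
  have hprod : ∀ i j k l, (M i * M j) k l = inner ℝ (g i k) (g j l)
      - (if i = k then lam i else 0) * (if j = l then lam j else 0) := by
    intro i j k l
    have e1 : inner ℝ (g i k) (g j l) = inner ℝ (g i k) (∑ s, inner ℝ (h s) (g j l) • h s + inner ℝ nu (g j l) • nu) := by
      rw [← hx]
    rw [e1, inner_add_right, inner_sum, inner_smul_right, real_inner_comm nu (g i k), hnu, hnu, Matrix.mul_apply]
    have : ∀ s, M i k s * M j s l = inner ℝ (g i k) (inner ℝ (h s) (g j l) • h s) := by
      intro s
      rw [inner_smul_right, hM, hM, h23 j s l, real_inner_comm]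
      simp only [hc]; ring
    rw [Finset.sum_congr rfl (fun s _ => this s)]
    ring
  have hggs : ∀ i j k l, inner ℝ (g i k) (g j l) = inner ℝ (g j k) (g i l) := by
    intro i j k l
    rw [gs i k, gg, gs k j]
  have hcomm : ∀ i j, M i * M j - M j * M i =
      Matrix.of fun k l => lam i * lam j * ((if j = k then 1 else 0) * (if i = l then 1 else 0)
        - (if i = k then 1 else 0) * (if j = l then 1 else 0)) := by
    intro i j
    ext k l
    rw [Matrix.sub_apply, hprod, hprod, hggs i j, Matrix.of_apply]
    split_ifs <;> ring
  have c0 : ∀ j k, c 0 j k = inner ℝ (h j) (h k) := fun j k => by simp only [hc, g0]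
  by_cases hl : ∃ i j, i ≠ j ∧ lam i ≠ 0 ∧ lam j ≠ 0
  · obtain ⟨d, hd⟩ := exists_d lam c h12 h23 M hM l0 (by
      intro j k
      rw [c0]
      split_ifs with hjk
      · subst hjk
        rcases h1 j with h | h <;> rw [h]; simp
      · rw [hh j k hjk]) (fun j k hjk => by rw [c0, hh j k hjk]) hcomm hl
    let N : Fin 4 → Matrix (Fin 4) Unit ℝ := fun i => Matrix.of fun k _ => if i = k then lam i else 0
    let D : Fin 4 → Matrix Unit Unit ℝ := fun i => Matrix.of fun _ _ => d i
    have hD : ∀ i, (D i).transpose = D i := fun _ => rfl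
    let Y : Fin 4 → Matrix (Fin 4 ⊕ Unit) (Fin 4 ⊕ Unit) ℝ := fun i =>
      Matrix.fromBlocks (M i) (N i) (N i).transpose (D i)
    obtain ⟨v, y, hv, hy⟩ := exists_joint_eigenvector Y (by
      intro i
      simp only [Y, Matrix.fromBlocks_transpose, hMt, Matrix.transpose_transpose]
      rfl) (by
      intro i j
      have a1 : ∀ k, (M i * N j) k () = lam j * c i j k := by
        intro k
        simp only [Matrix.mul_apply, N, Matrix.of_apply, hM]
        simp [h23 i k j, mul_comm]
      have b1 : ∀ k, (M j * N i) k () = lam i * c i j k := by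
        intro k
        simp only [Matrix.mul_apply, N, Matrix.of_apply, hM]
        simp [h23 j k i, h12 j i k, mul_comm]
      have e12 : M i * N j + N i * D j = M j * N i + N j * D i := by
        ext k u
        simp only [Matrix.add_apply, a1, b1]
        simp [Matrix.mul_apply, N, D]
        have := hd i j k
        split_ifs at this ⊢ <;> linarith
      simp only [Y, Matrix.fromBlocks_multiply]
      congr 1
      · ext k l
        have := congrFun (congrFun (hcomm i j) k) l
        simp only [Matrix.sub_apply, Matrix.of_apply] at this
        simp only [Matrix.add_apply, Matrix.mul_apply (M := N _), N, Matrix.transpose_apply, Matrix.of_apply]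
        simp only [Finset.univ_unique, Finset.sum_const, Finset.card_singleton, one_smul]
        split_ifs at this ⊢ <;> linarith
      · have := congrArg Matrix.transpose e12
        simp only [Matrix.transpose_add, Matrix.transpose_mul, hMt, hD] at this
        exact this.symm
      · ext
        by_cases hij : i = j
        · subst hij; rfl
        · simp [Matrix.mul_apply, N, D, hij, mul_comm]
        ) (Sum.inl 0)
    refine ⟨∑ s, v (Sum.inl s) • h s + v (Sum.inr ()) • nu, ?_⟩
    have key : ∀ i j, inner ℝ (g i j) (∑ s, v (Sum.inl s) • h s + v (Sum.inr ()) • nu) = y i * v (Sum.inl j) := by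
      intro i j
      have := congrFun (hy i) (Sum.inl j)
      simp only [Pi.smul_apply, smul_eq_mul] at this
      rw [← this, inner_add_right, inner_sum, inner_smul_right, real_inner_comm nu, hnu]
      simp [Matrix.mulVec, dotProduct, Y, N, hM, hc, inner_smul_right, mul_comm]
    have y0 : y 0 = 1 := by
      have := key 0 0
      rw [hv, g0, inner_add_right, inner_sum, inner_smul_right, ← g0 0, real_inner_comm nu, hnu] at this
      simp only [g0, inner_smul_right] at this
      rw [Finset.sum_eq_single 0 (fun b _ hb => by rw [hh 0 b hb.symm, mul_zero]) (by simp)] at this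
      rw [h00, hv] at this
      simpa [l0] using this.symm
    have hyv : ∀ j, v (Sum.inl j) = y j := by
      intro j
      have e1 := key 0 j
      have e2 := key j 0
      rw [gs j 0, e1, y0, hv] at e2
      linarith
    exact ⟨y, y0, fun i j => by rw [key, hyv]⟩
  · push Not at hl
    have hcm : ∀ i j, M i * M j = M j * M i := by
      intro i j
      rw [← sub_eq_zero, hcomm]
      ext k l
      simp only [Matrix.of_apply, Matrix.zero_apply]
      by_cases hij : i = j
      · subst hij; ring
      · by_cases hi : lam i = 0
        · simp [hi]
        · simp [hl i j hij hi]
    obtain ⟨v, y, hv, hy⟩ := exists_joint_eigenvector M hMt hcm 0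
    refine ⟨∑ s, v s • h s, ?_⟩
    have key : ∀ i j, inner ℝ (g i j) (∑ s, v s • h s) = y i * v j := by
      intro i j
      have := congrFun (hy i) j
      simp only [Pi.smul_apply, smul_eq_mul] at this
      rw [← this, inner_sum]
      simp [Matrix.mulVec, dotProduct, hM, hc, inner_smul_right, mul_comm]
    have y0 : y 0 = 1 := by
      have := key 0 0
      rw [hv, g0, inner_sum] at this
      simp only [inner_smul_right] at this
      rw [Finset.sum_eq_single 0 (fun b _ hb => by rw [hh 0 b hb.symm, mul_zero]) (by simp)] at this
      rw [h00, hv] at this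
      simpa using this.symm
    have hyv : ∀ j, v j = y j := by
      intro j
      have e1 := key 0 j
      have e2 := key j 0
      rw [gs j 0, e1, y0, hv] at e2
      linarith
    exact ⟨y, y0, fun i j => by rw [key, hyv]⟩

/-- A generic element acts injectively. -/
lemma exists_mul_injective {U E : Type} [AddCommGroup U] [Module ℝ U] [FiniteDimensional ℝ U]
    [NormedAddCommGroup E] [InnerProductSpace ℝ E] [FiniteDimensional ℝ E]
    (m : U →ₗ[ℝ] U →ₗ[ℝ] E) (hs : ∀ p q, m p q = m q p)
    (h4 : ∀ p q r s, inner ℝ (m p q) (m r s) = inner ℝ (m p r) (m q s))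
    (hnd : ∀ w, (∀ z, m z w = 0) → w = 0) : ∃ L, Function.Injective (m L) := by
  classical
  let S : Set ℕ := Set.range fun u => Module.finrank ℝ (LinearMap.range (m u))
  have hSb : BddAbove S := ⟨Module.finrank ℝ E, by
    rintro _ ⟨u, rfl⟩; exact Submodule.finrank_le _⟩
  have hSn : S.Nonempty := ⟨_, ⟨0, rfl⟩⟩
  obtain ⟨u, hu⟩ := Nat.sSup_mem hSn hSb
  have hmax : ∀ u', Module.finrank ℝ (LinearMap.range (m u')) ≤ Module.finrank ℝ (LinearMap.range (m u)) := by
    intro u'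
    have : Module.finrank ℝ (LinearMap.range (m u)) = sSup S := hu
    rw [this]
    exact le_csSup hSb ⟨u', rfl⟩
  refine ⟨u, ?_⟩
  rw [← LinearMap.ker_eq_bot, LinearMap.ker_eq_bot']
  intro w hw
  by_contra hw0
  have : ∃ z, m z w ≠ 0 := by
    by_contra hcon
    push Not at hcon
    exact hw0 (hnd w hcon)
  obtain ⟨z, hz⟩ := this
  have horth : ∀ x ∈ LinearMap.range (m u), inner ℝ (m z w) x = 0 := by
    rintro _ ⟨s, rfl⟩
    rw [hs z w, h4, hs w u, hw, inner_zero_left]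
  have hnot : m z w ∉ LinearMap.range (m u) := by
    intro hmem
    exact hz (inner_self_eq_zero.mp (horth _ hmem))
  set r := Module.finrank ℝ (LinearMap.range (m u)) with hr
  let bs := Module.finBasis ℝ (LinearMap.range (m u))
  have hpre : ∀ i, ∃ s, m u s = bs i := fun i => (bs i).2
  choose b hb using hpre
  have hli : LinearIndependent ℝ (fun i : Fin r => m u (b i)) := by
    have := bs.linearIndependent.map' (LinearMap.range (m u)).subtype (Submodule.ker_subtype _)
    have e : (fun i : Fin r => m u (b i)) = (LinearMap.range (m u)).subtype ∘ bs := funext hb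
    rw [e]
    exact this
  let F : ℝ → (Option (Fin r) → E) := fun t o => Option.casesOn' o (m z w) (fun i => m u (b i) + t • m z (b i))
  have hF0 : LinearIndependent ℝ (F 0) := by
    have : F 0 = fun o : Option (Fin r) => Option.casesOn' o (m z w) (fun i => m u (b i)) := by
      funext o
      cases o <;> simp [F]
    rw [this]
    refine LinearIndependent.option hli ?_
    intro hmem
    apply hnot
    have : Submodule.span ℝ (Set.range fun i : Fin r => m u (b i)) ≤ LinearMap.range (m u) := by
      rw [Submodule.span_le]
      rintro _ ⟨i, rfl⟩
      exact ⟨_, rfl⟩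
    exact this hmem
  have hFc : Continuous F := by
    apply continuous_pi
    intro o
    cases o with
    | none => exact continuous_const
    | some i =>
      change Continuous fun t : ℝ => m u (b i) + t • m z (b i)
      fun_prop
  have hopen : IsOpen (F ⁻¹' {f | LinearIndependent ℝ f}) := isOpen_setOfPred_linearIndependent.preimage hFc
  obtain ⟨e, he, hball⟩ := Metric.isOpen_iff.mp hopen 0 hF0
  have ht : LinearIndependent ℝ (F (e / 2)) := by
    apply hball
    rw [Metric.mem_ball, Real.dist_eq, sub_zero, abs_of_pos (by linarith)]
    linarith
  have hrange : ∀ o, F (e / 2) o ∈ LinearMap.range (m (u + (e / 2) • z)) := by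
    intro o
    cases o with
    | none =>
      refine ⟨(e / 2)⁻¹ • w, ?_⟩
      have : e / 2 ≠ 0 := by positivity
      simp [F, hw, smul_smul]
      field_simp
      simp
    | some i => exact ⟨b i, by simp [F]⟩
  have hcard : Fintype.card (Option (Fin r)) ≤ Module.finrank ℝ (LinearMap.range (m (u + (e / 2) • z))) := by
    have h2 : LinearIndependent ℝ (fun o => (⟨F (e / 2) o, hrange o⟩ : LinearMap.range (m (u + (e / 2) • z)))) := by
      apply LinearIndependent.of_comp (LinearMap.range (m (u + (e / 2) • z))).subtype
      exact ht
    exact h2.fintype_card_le_finrank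
  have := hmax (u + (e / 2) • z)
  simp at hcard
  omega

/-- Diagonalization of a symmetric bilinear form on a subspace of dimension at most three, padded by zeros. -/
lemma exists_padded_basis {E : Type} [NormedAddCommGroup E] [InnerProductSpace ℝ E] [FiniteDimensional ℝ E]
    (G : Submodule ℝ E) (hG : Module.finrank ℝ G ≤ 3) (B : G →ₗ[ℝ] G →ₗ[ℝ] ℝ) (hB : ∀ x y, B x y = B y x) :
    ∃ (b : Fin 3 → G) (mu : Fin 3 → ℝ), (∀ i j, i ≠ j → inner ℝ (b i : E) (b j : E) = 0) ∧
      (∀ i, inner ℝ (b i : E) (b i : E) = 1 ∨ mu i = 0) ∧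
      (∀ x : E, x ∈ G → x = ∑ i, inner ℝ (b i : E) x • (b i : E)) ∧
      (∀ i j, B (b i) (b j) = if i = j then mu i else 0) := by
  classical
  let o := stdOrthonormalBasis ℝ G
  let T : G →ₗ[ℝ] G := ∑ i, (B.flip (o i)).smulRight (o i)
  have hT1 : ∀ x y, inner ℝ (T x) y = B x y := by
    intro x y
    have hy : y = ∑ i, inner ℝ (o i) y • o i := (o.sum_repr' y).symm
    conv_rhs => rw [hy]
    simp [T, sum_inner, inner_smul_left, mul_comm]
  have hT : T.IsSymmetric := by
    intro x y
    rw [hT1, real_inner_comm, hT1, hB]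
  let eb := hT.eigenvectorBasis rfl
  let ev := hT.eigenvalues rfl
  have heb : ∀ i, T (eb i) = ev i • eb i := fun i => hT.apply_eigenvectorBasis rfl i
  let n := Module.finrank ℝ G
  let b : Fin 3 → G := fun i => if h : (i : ℕ) < n then eb ⟨i, h⟩ else 0
  let mu : Fin 3 → ℝ := fun i => if h : (i : ℕ) < n then ev ⟨i, h⟩ else 0
  have hbpos : ∀ (i : Fin 3) (h : (i : ℕ) < n), b i = eb ⟨i, h⟩ := fun i h => by simp [b, h]
  have hbneg : ∀ (i : Fin 3) (h : ¬ (i : ℕ) < n), b i = 0 := fun i h => by simp [b, h]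
  have hmupos : ∀ (i : Fin 3) (h : (i : ℕ) < n), mu i = ev ⟨i, h⟩ := fun i h => by simp [mu, h]
  have hmuneg : ∀ (i : Fin 3) (h : ¬ (i : ℕ) < n), mu i = 0 := fun i h => by simp [mu, h]
  have horth : ∀ i j, i ≠ j → inner ℝ (b i) (b j) = 0 := by
    intro i j hij
    by_cases hi : (i : ℕ) < n
    · by_cases hj : (j : ℕ) < n
      · rw [hbpos i hi, hbpos j hj]
        apply eb.orthonormal.2
        intro h
        apply hij
        exact Fin.ext (by simpa using h)
      · rw [hbneg j hj, inner_zero_right]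
    · rw [hbneg i hi, inner_zero_left]
  refine ⟨b, mu, fun i j hij => horth i j hij, ?_, ?_, ?_⟩
  · intro i
    by_cases hi : (i : ℕ) < n
    · left
      have := eb.orthonormal.1 ⟨i, hi⟩
      rw [hbpos i hi]
      have h2 : inner ℝ (eb ⟨i, hi⟩) (eb ⟨i, hi⟩) = (1 : ℝ) := by
        rw [real_inner_self_eq_norm_sq, this]; norm_num
      exact h2
    · right; exact hmuneg i hi
  · intro x hx
    have h1 := eb.sum_repr' ⟨x, hx⟩
    have h2 := congrArg (Subtype.val) h1
    rw [AddSubmonoidClass.coe_finsetSum] at h2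
    refine h2.symm.trans ?_
    apply Fintype.sum_of_injective (Fin.castLE hG) (Fin.castLE_injective hG)
    · intro i hi
      have : ¬ (i : ℕ) < n := by
        intro h
        exact hi ⟨⟨i, h⟩, rfl⟩
      rw [hbneg i this]; simp
    · intro i
      have : ((Fin.castLE hG i : Fin 3) : ℕ) < n := i.2
      rw [hbpos _ this]
      rfl
  · intro i j
    rw [← hT1]
    by_cases hi : (i : ℕ) < n
    · have : T (b i) = mu i • b i := by rw [hbpos i hi, heb, hmupos i hi]
      rw [this, inner_smul_left]
      split_ifs with hij
      · subst hij
        rw [hbpos i hi, real_inner_self_eq_norm_sq, eb.orthonormal.1]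
        simp
      · rw [horth i j hij]; simp
    · rw [hbneg i hi, hmuneg i hi]; simp

/-- The main construction when `m L` is injective with image of codimension at most one. -/
lemma main_codim_one {U E : Type} [AddCommGroup U] [Module ℝ U] [FiniteDimensional ℝ U]
    [NormedAddCommGroup E] [InnerProductSpace ℝ E] [FiniteDimensional ℝ E]
    (m : U →ₗ[ℝ] U →ₗ[ℝ] E) (hs : ∀ p q, m p q = m q p)
    (h4 : ∀ p q r s, inner ℝ (m p q) (m r s) = inner ℝ (m p r) (m q s))
    (L : U) (hL : Function.Injective (m L)) (hL1 : inner ℝ (m L L) (m L L) = (1 : ℝ))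
    (hU : Module.finrank ℝ U ≤ 4) (hE : Module.finrank ℝ E ≤ Module.finrank ℝ U + 1) :
    ∃ (y : U →ₗ[ℝ] ℝ) (v : E), y ≠ 0 ∧ ∀ p q, inner ℝ (m p q) v = y p * y q := by
  classical
  set H := LinearMap.range (m L) with hH
  let rho : U ≃ₗ[ℝ] H := LinearEquiv.ofInjective (m L) hL
  have hrho : ∀ p, (rho p : E) = m L p := fun p => rfl
  have hrho' : ∀ x : H, m L (rho.symm x) = x := fun x => by rw [← hrho, LinearEquiv.apply_symm_apply]
  have hfH : Module.finrank ℝ H = Module.finrank ℝ U := rho.finrank_eq.symm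
  -- the normal vector
  have hnu : ∃ nu : E, (∀ x ∈ H, inner ℝ nu x = 0) ∧ ∀ x ∈ Hᗮ, x = inner ℝ nu x • nu := by
    have hsum := H.finrank_add_finrank_orthogonal
    by_cases hbot : Hᗮ = ⊥
    · refine ⟨0, by simp, ?_⟩
      intro x hx
      rw [hbot, Submodule.mem_bot] at hx
      simp [hx]
    · obtain ⟨w, hw, hw0⟩ := Submodule.exists_mem_ne_zero_of_ne_bot hbot
      have hpos : 0 < Module.finrank ℝ Hᗮ := Module.finrank_pos_iff_exists_ne_zero.mpr
        ⟨⟨w, hw⟩, fun h => hw0 (congrArg Subtype.val h)⟩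
      have hone : Module.finrank ℝ Hᗮ = 1 := by omega
      have hall := (finrank_eq_one_iff_of_nonzero' (⟨w, hw⟩ : Hᗮ) (fun h => hw0 (congrArg Subtype.val h))).mp hone
      have hwn : ‖w‖ ≠ 0 := norm_ne_zero_iff.mpr hw0
      refine ⟨‖w‖⁻¹ • w, ?_, ?_⟩
      · intro x hx
        rw [inner_smul_left, real_inner_comm, (Submodule.mem_orthogonal _ _).mp hw x hx]; simp
      · intro x hx
        obtain ⟨c, hc⟩ := hall ⟨x, hx⟩
        have hc' : c • w = x := congrArg Subtype.val hc
        rw [← hc', inner_smul_right, inner_smul_left, real_inner_self_eq_norm_sq, smul_smul]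
        congr 1
        simp
        field_simp
  obtain ⟨nu, hnu1, hnu2⟩ := hnu
  let h0 : E := m L L
  have h0H : h0 ∈ H := ⟨L, rfl⟩
  let G : Submodule ℝ E := (Submodule.span ℝ {h0})ᗮ ⊓ H
  have hGH : G ≤ H := inf_le_right
  have hG0 : ∀ x, x ∈ G ↔ inner ℝ h0 x = 0 ∧ x ∈ H := by
    intro x
    simp [G, Submodule.mem_orthogonal_singleton_iff_inner_right]
  have hGlt : G < H := by
    refine lt_of_le_of_ne hGH ?_
    intro heq
    have : h0 ∈ G := heq ▸ h0H
    have := ((hG0 _).mp this).1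
    rw [hL1] at this
    exact one_ne_zero this
  have hGf : Module.finrank ℝ G ≤ 3 := by
    have := Submodule.finrank_lt_finrank_of_lt hGlt
    omega
  let tau : G →ₗ[ℝ] U := rho.symm.toLinearMap ∘ₗ Submodule.inclusion hGH
  have htau : ∀ x : G, m L (tau x) = x := fun x => hrho' _
  let B : G →ₗ[ℝ] G →ₗ[ℝ] ℝ := (m.compl₁₂ tau tau).compr₂ (innerₛₗ ℝ nu)
  have hB : ∀ x y, B x y = inner ℝ nu (m (tau x) (tau y)) := fun x y => rfl
  obtain ⟨b, mu, hb1, hb2, hb3, hb4⟩ := exists_padded_basis G hGf B (fun x y => by rw [hB, hB, hs])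
  let e : Fin 4 → U := Fin.cons L (fun i => tau (b i))
  let h : Fin 4 → E := Fin.cons h0 (fun i => (b i : E))
  let lam : Fin 4 → ℝ := Fin.cons 0 mu
  have he : ∀ i, m L (e i) = h i := by
    intro i
    refine Fin.cases ?_ (fun i => ?_) i
    · rfl
    · exact htau _
  have hexp : ∀ x ∈ H, x = ∑ i, inner ℝ (h i) x • h i := by
    intro x hx
    rw [Fin.sum_univ_succ]
    change x = inner ℝ h0 x • h0 + ∑ i, inner ℝ (b i : E) x • (b i : E)
    have hz : x - inner ℝ h0 x • h0 ∈ G := by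
      rw [hG0]
      refine ⟨?_, H.sub_mem hx (H.smul_mem _ h0H)⟩
      rw [inner_sub_right, inner_smul_right, hL1]; ring
    have h5 := hb3 _ hz
    have h6 : ∀ i, inner ℝ (b i : E) (x - inner ℝ h0 x • h0) = inner ℝ (b i : E) x := by
      intro i
      rw [inner_sub_right, inner_smul_right, real_inner_comm h0, ((hG0 _).mp (b i).2).1]; ring
    simp only [h6] at h5
    rw [← h5]; abel
  obtain ⟨v, y, hy0, hy⟩ := core_coords h nu (fun i j => m (e i) (e j)) lam
    (fun i j => hs _ _) (fun i j k l => h4 _ _ _ _) he (by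
      intro i j
      refine Fin.cases ?_ (fun i => ?_) i <;> refine Fin.cases ?_ (fun j => ?_) j
      · intro h; exact absurd rfl h
      · intro _; exact ((hG0 _).mp (b j).2).1
      · intro _
        rw [real_inner_comm]
        exact ((hG0 _).mp (b i).2).1
      · intro hij
        exact hb1 i j (fun h => hij (by rw [h]))) hL1 (by
      intro i
      refine Fin.cases ?_ (fun i => ?_) i
      · left; exact hL1
      · exact hb2 i) (by
      intro x
      obtain ⟨a, ha, c, hc, rfl⟩ := H.exists_add_mem_mem_orthogonal x
      have hha : ∀ i, h i ∈ H := fun i => ⟨e i, he i⟩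
      have e1 : ∀ i, inner ℝ (h i) (a + c) = inner ℝ (h i) a := by
        intro i
        rw [inner_add_right, (Submodule.mem_orthogonal _ _).mp hc _ (hha i), add_zero]
      simp only [e1]
      rw [inner_add_right, hnu1 a ha, zero_add, ← hexp a ha, ← hnu2 c hc]) (by
      intro i j
      refine Fin.cases ?_ (fun i => ?_) i <;> refine Fin.cases ?_ (fun j => ?_) j
      · exact hnu1 _ ⟨_, rfl⟩
      · rw [if_neg (Fin.succ_ne_zero j).symm]
        exact hnu1 _ ⟨_, rfl⟩
      · rw [if_neg (Fin.succ_ne_zero i), hs]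
        exact hnu1 _ ⟨_, rfl⟩
      · have := hb4 i j
        rw [hB] at this
        simp only [Fin.succ_inj]
        exact this) rfl
  have hp : ∀ p, p = ∑ i, inner ℝ (h i) (m L p) • e i := by
    intro p
    apply hL
    rw [map_sum]
    simp only [map_smul, he]
    exact hexp _ ⟨p, rfl⟩
  let yy : U →ₗ[ℝ] ℝ := ∑ i, y i • (innerₛₗ ℝ (h i)).comp (m L)
  have hyy : ∀ p, yy p = ∑ i, inner ℝ (h i) (m L p) * y i := by
    intro p
    simp [yy, mul_comm]
  refine ⟨yy, v, ?_, ?_⟩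
  · intro hzero
    have h7 := hy 0 0
    have h8 : yy L = 0 := by rw [hzero]; rfl
    rw [hyy, Fin.sum_univ_succ] at h8
    have h9 : ∀ i : Fin 3, inner ℝ (h i.succ) (m L L) = 0 := fun i => by
      rw [real_inner_comm]; exact ((hG0 _).mp (b i).2).1
    simp only [h9] at h8
    have h10 : inner ℝ (h 0) (m L L) = (1:ℝ) := hL1
    rw [h10, hy0] at h8
    simp at h8
  · intro p q
    conv_lhs => rw [hp p, hp q]
    simp only [map_sum, LinearMap.sum_apply, map_smul, LinearMap.smul_apply, sum_inner, inner_smul_left, hy,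
      hyy, Finset.mul_sum, Finset.sum_mul, conj_trivial]
    refine Finset.sum_congr rfl fun i _ => Finset.sum_congr rfl fun j _ => ?_
    ring

lemma sign_of_no_zero (q : (Fin 3 → ℝ) → ℝ) (hc : Continuous q) (h : ∀ y, y ≠ 0 → q y ≠ 0) :
    (∀ y, y ≠ 0 → 0 < q y) ∨ (∀ y, y ≠ 0 → q y < 0) := by
  have hcon : IsConnected ({0}ᶜ : Set (Fin 3 → ℝ)) := by
    apply isConnected_compl_singleton_of_one_lt_rank
    rw [rank_fin_fun]
    norm_num
  by_contra hcontra
  push Not at hcontra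
  obtain ⟨⟨y, hy, hy1⟩, z, hz, hz1⟩ := hcontra
  have := hcon.isPreconnected.intermediate_value (a := y) (b := z) hy hz hc.continuousOn
  obtain ⟨w, hw, hw1⟩ := this ⟨hy1, hz1⟩
  exact h w hw hw1

lemma bilin_mem_of_basis {ι U E : Type} [Fintype ι] [AddCommGroup U] [Module ℝ U]
    [AddCommGroup E] [Module ℝ E] (m : U →ₗ[ℝ] U →ₗ[ℝ] E) (b : Module.Basis ι ℝ U)
    (N : Submodule ℝ E) (h : ∀ i j, m (b i) (b j) ∈ N) (p q : U) : m p q ∈ N := by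
  rw [← b.sum_repr p, ← b.sum_repr q]
  simp only [map_sum, LinearMap.sum_apply, map_smul, LinearMap.smul_apply]
  exact N.sum_mem fun i _ => N.smul_mem _ (N.sum_mem fun j _ => N.smul_mem _ (h _ _))

/-- The case of three variables and a five dimensional target. -/
lemma case_three_five {U E : Type} [AddCommGroup U] [Module ℝ U]
    [NormedAddCommGroup E] [InnerProductSpace ℝ E] [FiniteDimensional ℝ E]
    (m : U →ₗ[ℝ] U →ₗ[ℝ] E) (hs : ∀ p q, m p q = m q p)
    (h4 : ∀ p q r s, inner ℝ (m p q) (m r s) = inner ℝ (m p r) (m q s))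
    (hspan : ∀ N : Submodule ℝ E, (∀ p q, m p q ∈ N) → N = ⊤)
    (b : Module.Basis (Fin 3) ℝ U) (hE : Module.finrank ℝ E = 5) :
    ∃ (y : U →ₗ[ℝ] ℝ) (v : E), y ≠ 0 ∧ ∀ p q, inner ℝ (m p q) v = y p * y q := by
  classical
  let g : Fin 6 → E := ![m (b 0) (b 0), m (b 1) (b 1), m (b 2) (b 2), m (b 0) (b 1), m (b 0) (b 2), m (b 1) (b 2)]
  let Φ : (Fin 6 → ℝ) →ₗ[ℝ] E := Fintype.linearCombination ℝ g
  have hΦ : ∀ a, Φ a = a 0 • m (b 0) (b 0) + a 1 • m (b 1) (b 1) + a 2 • m (b 2) (b 2)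
      + a 3 • m (b 0) (b 1) + a 4 • m (b 0) (b 2) + a 5 • m (b 1) (b 2) := by
    intro a
    simp [Φ, Fintype.linearCombination_apply, Fin.sum_univ_six, g]
  have hgm : ∀ i, g i ∈ LinearMap.range Φ := by
    intro i
    refine ⟨Pi.single i 1, ?_⟩
    simp [Φ]
  have hsurj : LinearMap.range Φ = ⊤ := by
    apply hspan
    apply bilin_mem_of_basis m b
    intro i j
    fin_cases i <;> fin_cases j
    · exact hgm 0
    · exact hgm 3
    · exact hgm 4
    · have := hgm 3
      change m (b 0) (b 1) ∈ _ at this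
      rw [hs] at this
      exact this
    · exact hgm 1
    · exact hgm 5
    · have := hgm 4
      change m (b 0) (b 2) ∈ _ at this
      rw [hs] at this
      exact this
    · have := hgm 5
      change m (b 1) (b 2) ∈ _ at this
      rw [hs] at this
      exact this
    · exact hgm 2
  have hker : Module.finrank ℝ (LinearMap.ker Φ) = 1 := by
    have := LinearMap.finrank_range_add_finrank_ker Φ
    rw [hsurj, finrank_top, hE] at this
    simp at this
    omega
  obtain ⟨⟨a, ha⟩, ha0, hall⟩ := finrank_eq_one_iff'.mp hker
  have haker : Φ a = 0 := ha
  let q : (Fin 3 → ℝ) → ℝ := fun y => a 0 * (y 0 * y 0) + a 1 * (y 1 * y 1) + a 2 * (y 2 * y 2)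
    + a 3 * (y 0 * y 1) + a 4 * (y 0 * y 2) + a 5 * (y 1 * y 2)
  by_cases hq : ∀ y, y ≠ 0 → q y ≠ 0
  · exfalso
    have hsign := sign_of_no_zero q (by fun_prop) hq
    have hzero : ∀ u i, m (b i) u = 0 := by
      intro u
      let o := stdOrthonormalBasis ℝ E
      let y : Fin (Module.finrank ℝ E) → Fin 3 → ℝ := fun k i => inner ℝ (m (b i) u) (o k)
      have hij : ∀ i j, ∑ k, y k i * y k j = inner ℝ (m (b i) (b j)) (m u u) := by
        intro i j
        rw [h4, ← o.sum_inner_mul_inner]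
        refine Finset.sum_congr rfl fun k _ => ?_
        simp only [y]
        rw [real_inner_comm (o k) (m (b j) u)]
      have hsum : ∑ k, q (y k) = 0 := by
        simp only [q, Finset.sum_add_distrib, ← Finset.mul_sum, hij]
        simp only [← real_inner_smul_left, ← inner_add_left]
        rw [← hΦ, haker, inner_zero_left]
      have hq0 : q 0 = 0 := by simp [q]
      have hyk : ∀ k, y k = 0 := by
        intro k
        by_contra hne
        rcases hsign with hp | hn
        · have := (Finset.sum_eq_zero_iff_of_nonneg (fun k _ => by
            by_cases h : y k = 0
            · rw [h, hq0]
            · exact (hp _ h).le)).mp hsum k (Finset.mem_univ _)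
          exact hq _ hne this
        · have := (Finset.sum_eq_zero_iff_of_nonpos (fun k _ => by
            by_cases h : y k = 0
            · rw [h, hq0]
            · exact (hn _ h).le)).mp hsum k (Finset.mem_univ _)
          exact hq _ hne this
      intro i
      rw [← o.sum_repr' (m (b i) u)]
      refine Finset.sum_eq_zero fun k _ => ?_
      have h1 : inner ℝ (m (b i) u) (o k) = 0 := congrFun (hyk k) i
      rw [real_inner_comm, h1, zero_smul]
    have hbt : (⊥ : Submodule ℝ E) = ⊤ := by
      apply hspan
      apply bilin_mem_of_basis m b
      intro i j
      rw [hzero]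
      exact Submodule.zero_mem _
    have : Module.finrank ℝ (⊤ : Submodule ℝ E) = 0 := by rw [← hbt, finrank_bot]
    rw [finrank_top] at this
    omega
  · push Not at hq
    obtain ⟨y, hy0, hy⟩ := hq
    let phi : (Fin 6 → ℝ) →ₗ[ℝ] ℝ := Fintype.linearCombination ℝ
      ![y 0 * y 0, y 1 * y 1, y 2 * y 2, y 0 * y 1, y 0 * y 2, y 1 * y 2]
    have hphi : ∀ c, phi c = c 0 * (y 0 * y 0) + c 1 * (y 1 * y 1) + c 2 * (y 2 * y 2)
      + c 3 * (y 0 * y 1) + c 4 * (y 0 * y 2) + c 5 * (y 1 * y 2) := by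
      intro c
      simp [phi, Fintype.linearCombination_apply, Fin.sum_univ_six]
    have hphiker : ∀ c, Φ c = 0 → phi c = 0 := by
      intro c hc
      obtain ⟨t, ht⟩ := hall ⟨c, hc⟩
      have ht' : t • a = c := congrArg Subtype.val ht
      rw [← ht', map_smul, hphi]
      change t • q y = 0
      rw [hy, smul_zero]
    obtain ⟨R, hR⟩ := Φ.exists_rightInverse_of_surjective hsurj
    let psi : E →ₗ[ℝ] ℝ := phi ∘ₗ R
    have hpsi : ∀ c, psi (Φ c) = phi c := by
      intro c
      have h1 : Φ (R (Φ c)) = Φ c := LinearMap.congr_fun hR (Φ c)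
      have h2 : Φ (R (Φ c) - c) = 0 := by rw [map_sub, h1, sub_self]
      have h3 := hphiker _ h2
      rw [map_sub, sub_eq_zero] at h3
      exact h3
    let v : E := (InnerProductSpace.toDual ℝ E).symm (LinearMap.toContinuousLinearMap psi)
    have hv : ∀ x, inner ℝ x v = psi x := by
      intro x
      rw [real_inner_comm]
      simp [v]
    have hg : ∀ i, psi (g i) = ![y 0 * y 0, y 1 * y 1, y 2 * y 2, y 0 * y 1, y 0 * y 2, y 1 * y 2] i := by
      intro i
      have h1 : Φ (Pi.single i 1) = g i := by simp [Φ]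
      rw [← h1, hpsi]
      simp [phi]
    have hbb : ∀ i j, psi (m (b i) (b j)) = y i * y j := by
      intro i j
      fin_cases i <;> fin_cases j
      · exact hg 0
      · exact hg 3
      · exact hg 4
      · have := hg 3
        change psi (m (b 0) (b 1)) = y 0 * y 1 at this
        rw [hs, mul_comm] at this
        exact this
      · exact hg 1
      · exact hg 5
      · have := hg 4
        change psi (m (b 0) (b 2)) = y 0 * y 2 at this
        rw [hs, mul_comm] at this
        exact this
      · have := hg 5
        change psi (m (b 1) (b 2)) = y 1 * y 2 at this
        rw [hs, mul_comm] at this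
        exact this
      · exact hg 2
    let yy : U →ₗ[ℝ] ℝ := b.constr ℝ y
    have hyy : ∀ i, yy (b i) = y i := fun i => by simp [yy]
    refine ⟨yy, v, ?_, ?_⟩
    · intro h
      apply hy0
      funext i
      rw [← hyy, h]; rfl
    · intro p q
      rw [hv]
      have : m.compr₂ psi = (LinearMap.mul ℝ ℝ).compl₁₂ yy yy := by
        apply b.ext
        intro i
        apply b.ext
        intro j
        simp [hbb, hyy]
      exact LinearMap.congr_fun (LinearMap.congr_fun this p) q

/-- The nondegenerate case. -/
lemma exists_point_nondeg {U E : Type} [AddCommGroup U] [Module ℝ U] [FiniteDimensional ℝ U]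
    [NormedAddCommGroup E] [InnerProductSpace ℝ E] [FiniteDimensional ℝ E]
    (m : U →ₗ[ℝ] U →ₗ[ℝ] E) (hs : ∀ p q, m p q = m q p)
    (h4 : ∀ p q r s, inner ℝ (m p q) (m r s) = inner ℝ (m p r) (m q s))
    (hspan : ∀ N : Submodule ℝ E, (∀ p q, m p q ∈ N) → N = ⊤)
    (hnd : ∀ w, (∀ z, m z w = 0) → w = 0)
    (hU : Module.finrank ℝ U ≤ 4) (hE : Module.finrank ℝ E ≤ 5) (hE0 : 0 < Module.finrank ℝ E) :
    ∃ (y : U →ₗ[ℝ] ℝ) (v : E), y ≠ 0 ∧ ∀ p q, inner ℝ (m p q) v = y p * y q := by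
  classical
  by_cases hc : Module.finrank ℝ E ≤ Module.finrank ℝ U + 1
  · obtain ⟨L, hL⟩ := exists_mul_injective m hs h4 hnd
    have hmL : m L L ≠ 0 := by
      intro h0
      have hL0 : L = 0 := hL (by rw [h0, map_zero])
      have hz : ∀ p : U, p = 0 := fun p => hL (by rw [hL0]; simp)
      have hbt : (⊥ : Submodule ℝ E) = ⊤ := by
        apply hspan
        intro p q
        rw [hz p]; simp
      have : Module.finrank ℝ (⊤ : Submodule ℝ E) = 0 := by rw [← hbt, finrank_bot]
      rw [finrank_top] at this
      omega
    have hn : 0 < ‖m L L‖ := norm_pos_iff.mpr hmL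
    set t : ℝ := (Real.sqrt ‖m L L‖)⁻¹ with ht
    have hsq : 0 < Real.sqrt ‖m L L‖ := Real.sqrt_pos.mpr hn
    have ht0 : t ≠ 0 := inv_ne_zero hsq.ne'
    have htt : t * t * ‖m L L‖ = 1 := by
      have := Real.mul_self_sqrt hn.le
      rw [ht]
      field_simp
      nlinarith
    refine main_codim_one m hs h4 (t • L) ?_ ?_ hU hc
    · intro p q hpq
      simp only [map_smul, LinearMap.smul_apply] at hpq
      exact hL (smul_right_injective _ ht0 hpq)
    · simp only [map_smul, LinearMap.smul_apply]
      rw [smul_smul, real_inner_self_eq_norm_sq, norm_smul, Real.norm_eq_abs, abs_mul_self, htt]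
      norm_num
  · have hcases : Module.finrank ℝ U = 0 ∨ Module.finrank ℝ U = 1 ∨ Module.finrank ℝ U = 2 ∨
      Module.finrank ℝ U = 3 := by omega
    have hbound : ∀ (n : ℕ) (g : Fin n → E) (k : ℕ) (b : Module.Basis (Fin k) ℝ U),
        (∀ i j, m (b i) (b j) ∈ Set.range g) → Module.finrank ℝ E ≤ n := by
      intro n g k b hb
      have : Submodule.span ℝ (Set.range g) = ⊤ := by
        apply hspan
        apply bilin_mem_of_basis m b
        intro i j
        exact Submodule.subset_span (hb i j)
      have h2 := finrank_range_le_card (R := ℝ) g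
      rw [Set.finrank, this, finrank_top] at h2
      simpa using h2
    rcases hcases with h | h | h | h
    · have := hbound 0 ![] 0 (Module.finBasisOfFinrankEq ℝ U h) (fun i => i.elim0)
      omega
    · let b := Module.finBasisOfFinrankEq ℝ U h
      have := hbound 1 ![m (b 0) (b 0)] 1 b (fun i j => by
        fin_cases i; fin_cases j; exact ⟨0, rfl⟩)
      omega
    · let b := Module.finBasisOfFinrankEq ℝ U h
      have := hbound 3 ![m (b 0) (b 0), m (b 0) (b 1), m (b 1) (b 1)] 2 b (fun i j => by
        fin_cases i <;> fin_cases j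
        · exact ⟨0, rfl⟩
        · exact ⟨1, rfl⟩
        · exact ⟨1, hs _ _⟩
        · exact ⟨2, rfl⟩)
      omega
    · exact case_three_five m hs h4 hspan (Module.finBasisOfFinrankEq ℝ U h) (by omega)

/-- The general case. -/
lemma exists_point {U E : Type} [AddCommGroup U] [Module ℝ U] [FiniteDimensional ℝ U]
    [NormedAddCommGroup E] [InnerProductSpace ℝ E] [FiniteDimensional ℝ E]
    (m : U →ₗ[ℝ] U →ₗ[ℝ] E) (hs : ∀ p q, m p q = m q p)
    (h4 : ∀ p q r s, inner ℝ (m p q) (m r s) = inner ℝ (m p r) (m q s))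
    (hspan : ∀ N : Submodule ℝ E, (∀ p q, m p q ∈ N) → N = ⊤)
    (hU : Module.finrank ℝ U ≤ 4) (hE : Module.finrank ℝ E ≤ 5) (hE0 : 0 < Module.finrank ℝ E) :
    ∃ (y : U →ₗ[ℝ] ℝ) (v : E), y ≠ 0 ∧ ∀ p q, inner ℝ (m p q) v = y p * y q := by
  classical
  let K : Submodule ℝ U := LinearMap.ker m
  obtain ⟨S, hS⟩ := Submodule.exists_isCompl K
  let P : U →ₗ[ℝ] S := S.projectionOnto K hS.symm
  have hPs : ∀ s : S, P (s : U) = s := fun s => by simp [P]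
  have hPK : ∀ p : U, p - (P p : U) ∈ K := by
    intro p
    have h1 : P (p - (P p : U)) = 0 := by
      rw [map_sub, hPs, sub_self]
    have h2 : p - (P p : U) ∈ LinearMap.ker P := h1
    rwa [Submodule.ker_projectionOnto] at h2
  have hmP : ∀ p q, m p q = m (P p) (P q) := by
    intro p q
    have h1 : m (p - (P p : U)) = 0 := hPK p
    have h2 : m (q - (P q : U)) = 0 := hPK q
    rw [map_sub, sub_eq_zero] at h1 h2
    rw [h1, hs, h2, hs]
  let m' : S →ₗ[ℝ] S →ₗ[ℝ] E := m.compl₁₂ S.subtype S.subtype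
  have hm' : ∀ p q : S, m' p q = m p q := fun p q => rfl
  obtain ⟨y, v, hy0, hy⟩ := exists_point_nondeg m' (fun p q => hs _ _) (fun p q r s => h4 _ _ _ _)
    (by
      intro N hN
      apply hspan
      intro p q
      rw [hmP]
      exact hN _ _)
    (by
      intro w hw
      have : (w : U) ∈ K := by
        change m w = 0
        ext z
        rw [hs, hmP]
        have h3 := hw (P z)
        rw [hm'] at h3
        have h4 : P (w : U) = w := by simp [P]
        rw [h4]
        exact h3
      have h5 := (Submodule.disjoint_def.mp hS.disjoint) _ this w.2
      exact Subtype.ext h5)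
    ((Submodule.finrank_le S).trans hU) hE hE0
  refine ⟨y ∘ₗ P, v, ?_, ?_⟩
  · intro h
    apply hy0
    ext s
    have h1 := LinearMap.congr_fun h (s : U)
    have h2 : P (s : U) = s := by simp [P]
    simpa [h2] using h1
  · intro p q
    rw [hmP]
    exact hy _ _

open scoped MatrixOrder ComplexOrder in
lemma posSemidef_factor {n : ℕ} {M : Matrix (Fin n) (Fin n) ℝ} (hM : M.PosSemidef) :
    ∃ B : Matrix (Fin n) (Fin n) ℝ, M = B.conjTranspose * B :=
  CStarAlgebra.nonneg_iff_eq_star_mul_self.mp hM.nonneg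

/-- Separation of a boundary point of a convex cone. -/
lemma exists_supporting {P : Type} [AddCommGroup P] [Module ℝ P] [TopologicalSpace P]
    [IsTopologicalAddGroup P] [ContinuousSMul ℝ P] [T2Space P] [FiniteDimensional ℝ P]
    (C : Set P) (hconv : Convex ℝ C) (h0 : (0 : P) ∈ C) (hspan : Submodule.span ℝ C = ⊤)
    (hsm : ∀ x ∈ C, (2 : ℝ) • x ∈ C) (f : P) (hf : f ∈ C) (hint : f ∉ interior C) :
    ∃ l : P →ₗ[ℝ] ℝ, l ≠ 0 ∧ (∀ g ∈ C, 0 ≤ l g) ∧ l f = 0 := by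
  let e : P ≃L[ℝ] (Fin (Module.finrank ℝ P) → ℝ) := (Module.finBasis ℝ P).equivFun.toContinuousLinearEquiv
  have hD : Convex ℝ (e '' C) := hconv.linear_image e.toLinearEquiv.toLinearMap
  have himg : e '' interior C = interior (e '' C) := e.toHomeomorph.image_interior C
  have hne : (interior (e '' C)).Nonempty := by
    rw [hD.interior_nonempty_iff_affineSpan_eq_top]
    have hmem : (0 : Fin (Module.finrank ℝ P) → ℝ) ∈ e '' C := ⟨0, h0, by simp⟩
    have h1 : (affineSpan ℝ (e '' C) : Set (Fin (Module.finrank ℝ P) → ℝ)) = Submodule.span ℝ (e '' C) := by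
      conv_lhs => rw [← Set.insert_eq_of_mem hmem]
      rw [affineSpan_insert_zero]
    have h2 : Submodule.span ℝ (e '' C) = ⊤ := by
      have : e '' C = e.toLinearEquiv.toLinearMap '' C := rfl
      rw [this, Submodule.span_image, hspan, Submodule.map_top, LinearEquiv.range]
    apply SetLike.coe_injective
    rw [h1, h2]
    simp
  have hfi : e f ∉ interior (e '' C) := by
    rw [← himg]
    rintro ⟨x, hx, hxe⟩
    exact hint (e.injective hxe ▸ hx)
  obtain ⟨g, hg⟩ := geometric_hahn_banach_open_point hD.interior isOpen_interior hfi
  have hcl : ∀ x ∈ e '' C, g x ≤ g (e f) := by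
    intro x hx
    have h1 : x ∈ closure (interior (e '' C)) := by
      rw [hD.closure_interior_eq_closure_of_nonempty_interior hne]
      exact subset_closure hx
    exact closure_minimal (fun y hy => (hg y hy).le) (isClosed_le g.continuous continuous_const) h1
  have ha := hcl _ ⟨0, h0, rfl⟩
  have hb := hcl _ ⟨_, hsm f hf, rfl⟩
  simp only [map_zero, map_smul, smul_eq_mul] at ha hb
  have hz : g (e f) = 0 := by linarith
  refine ⟨-(g.toLinearMap ∘ₗ e.toLinearEquiv.toLinearMap), ?_, ?_, ?_⟩
  · intro h
    obtain ⟨x, hx⟩ := hne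
    have h1 := hg x hx
    have h2 := LinearMap.congr_fun h (e.symm x)
    simp at h2
    linarith
  · intro x hx
    have := hcl _ ⟨x, hx, rfl⟩
    simp
    linarith
  · simp [hz]

/-- A positive semidefinite form is a pulled back inner product. -/
lemma exists_factor {V : Type} [AddCommGroup V] [Module ℝ V] [FiniteDimensional ℝ V]
    (Q : V →ₗ[ℝ] V →ₗ[ℝ] ℝ) (hs : ∀ p q, Q p q = Q q p) (hp : ∀ p, 0 ≤ Q p p) :
    ∃ (n : ℕ) (S : V →ₗ[ℝ] EuclideanSpace ℝ (Fin n)), ∀ p q, Q p q = inner ℝ (S p) (S q) := by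
  classical
  let b := Module.finBasis ℝ V
  let M : Matrix (Fin (Module.finrank ℝ V)) (Fin (Module.finrank ℝ V)) ℝ := fun i j => Q (b i) (b j)
  have hQ : ∀ x y : Fin (Module.finrank ℝ V) → ℝ,
      Q (∑ i, x i • b i) (∑ i, y i • b i) = x ⬝ᵥ (M.mulVec y) := by
    intro x y
    simp only [map_sum, LinearMap.sum_apply, map_smul, LinearMap.smul_apply, dotProduct, Matrix.mulVec, M,
      Finset.mul_sum, smul_eq_mul]
    rw [Finset.sum_comm]
    refine Finset.sum_congr rfl fun i _ => Finset.sum_congr rfl fun j _ => ?_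
    ring
  have hM : M.PosSemidef := by
    refine Matrix.PosSemidef.of_dotProduct_mulVec_nonneg ?_ ?_
    · ext i j
      rw [Matrix.conjTranspose_apply, star_trivial]
      exact hs _ _
    · intro x
      rw [star_trivial, ← hQ]
      exact hp _
  obtain ⟨B, hB⟩ := posSemidef_factor hM
  refine ⟨_, (WithLp.linearEquiv 2 ℝ _).symm.toLinearMap ∘ₗ B.mulVecLin ∘ₗ b.equivFun.toLinearMap, ?_⟩
  intro p q
  conv_lhs => rw [← b.sum_equivFun p, ← b.sum_equivFun q, hQ, hB]
  have key : ∀ x y : Fin (Module.finrank ℝ V) → ℝ,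
      x ⬝ᵥ ((B.conjTranspose * B).mulVec y) = (B.mulVec x) ⬝ᵥ (B.mulVec y) := by
    intro x y
    rw [← Matrix.mulVec_mulVec, Matrix.dotProduct_mulVec, Matrix.vecMul_conjTranspose]
    simp
  rw [key]
  simp [PiLp.inner_apply, dotProduct, mul_comm]

/-- Sums of squares in a space of dimension at most four. -/
lemma four_squares_of_finrank {R : Type} [CommRing R] [Algebra ℝ R] (W : Submodule ℝ R)
    [FiniteDimensional ℝ W] (hW : Module.finrank ℝ W ≤ 4) {r : ℕ} (g : Fin r → R) (hg : ∀ i, g i ∈ W) :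
    ∃ h : Fin 4 → R, (∀ i, h i ∈ W) ∧ ∑ i, g i ^ 2 = ∑ i, h i ^ 2 := by
  classical
  let b := Module.finBasis ℝ W
  let w : Fin 4 → R := fun i => if hi : (i : ℕ) < Module.finrank ℝ W then (b ⟨i, hi⟩ : R) else 0
  have hw : ∀ i, w i ∈ W := by
    intro i
    by_cases hi : (i : ℕ) < Module.finrank ℝ W
    · simp only [w, dif_pos hi]; exact (b _).2
    · simp only [w, dif_neg hi]; exact W.zero_mem
  have hspan : ∀ x ∈ W, x ∈ Submodule.span ℝ (Set.range w) := by
    intro x hx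
    have h1 : x = ((∑ i, b.repr ⟨x, hx⟩ i • b i : W) : R) := by rw [b.sum_repr]
    rw [h1]
    simp only [Submodule.coe_sum, Submodule.coe_smul]
    refine Submodule.sum_mem _ fun i _ => Submodule.smul_mem _ _ (Submodule.subset_span ?_)
    refine ⟨⟨i, by omega⟩, ?_⟩
    simp [w]
  have hA : ∀ i, ∃ c : Fin 4 → ℝ, ∑ j, c j • w j = g i := fun i =>
    (Submodule.mem_span_range_iff_exists_fun ℝ).mp (hspan _ (hg i))
  choose A hA using hA
  have key : ∀ (k : ℕ) (D : Matrix (Fin k) (Fin 4) ℝ), ∑ i, (∑ j, D i j • w j) ^ 2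
      = ∑ j, ∑ l, (D.conjTranspose * D) j l • (w j * w l) := by
    intro k D
    simp only [Matrix.mul_apply, Matrix.conjTranspose_apply, star_trivial, Finset.sum_smul, sq,
      Finset.sum_mul_sum]
    rw [Finset.sum_comm]
    refine Finset.sum_congr rfl fun j _ => ?_
    rw [Finset.sum_comm]
    refine Finset.sum_congr rfl fun l _ => Finset.sum_congr rfl fun i _ => ?_
    rw [smul_mul_smul_comm]
  obtain ⟨B, hB⟩ := posSemidef_factor
    (Matrix.posSemidef_conjTranspose_mul_self (Matrix.of A))
  refine ⟨fun i => ∑ j, B i j • w j, fun i => W.sum_mem fun j _ => W.smul_mem _ (hw j), ?_⟩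
  rw [key 4 B, ← hB, ← key]
  refine Finset.sum_congr rfl fun i _ => ?_
  rw [← hA i]; rfl

lemma mono_split (a b : ℕ) (d : Fin 4 →₀ ℕ) (h : d.degree = a + b) :
    ∃ d1 d2 : Fin 4 →₀ ℕ, d1.degree = a ∧ d2.degree = b ∧ d = d1 + d2 := by
  obtain ⟨g, hg, hga⟩ := Finsupp.exists_le_degree_eq d a (by omega)
  obtain ⟨k, rfl⟩ := exists_add_of_le hg
  refine ⟨g, k, hga, ?_, rfl⟩
  rw [map_add] at h
  omega

lemma homog_mem (n : ℕ) (N : Submodule ℝ (MvPolynomial (Fin 4) ℝ))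
    (h : ∀ d : Fin 4 →₀ ℕ, d.degree = n → monomial d (1 : ℝ) ∈ N)
    (p : MvPolynomial (Fin 4) ℝ) (hp : p.IsHomogeneous n) : p ∈ N := by
  rw [← support_sum_monomial_coeff p]
  refine N.sum_mem fun d hd => ?_
  have h1 : monomial d (coeff d p) = coeff d p • monomial d (1 : ℝ) := by
    rw [smul_monomial, smul_eq_mul, mul_one]
  rw [h1]
  refine N.smul_mem _ (h d ?_)
  rw [Finsupp.degree_eq_weight_one]
  exact hp (mem_support_iff.mp hd)

lemma finDim_homog (n : ℕ) : FiniteDimensional ℝ (homogeneousSubmodule (Fin 4) ℝ n) := by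
  obtain ⟨T, hT, hT2⟩ : ∃ T : Set (MvPolynomial (Fin 4) ℝ), T.Finite ∧
      ∀ d : Fin 4 →₀ ℕ, d.degree = n → monomial d (1 : ℝ) ∈ T :=
    ⟨_, (Finsupp.finite_of_degree_eq n).image (fun d => monomial d (1 : ℝ)),
      fun d hd => Set.mem_image_of_mem _ hd⟩
  have h1 : FiniteDimensional ℝ (Submodule.span ℝ T) := FiniteDimensional.span_of_finite ℝ hT
  have h2 : homogeneousSubmodule (Fin 4) ℝ n ≤ Submodule.span ℝ T := fun p hp =>
    homog_mem n _ (fun d hd => Submodule.subset_span (hT2 d hd)) p hp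
  exact Submodule.finiteDimensional_of_le h2

/-- Linear forms. -/
def linForm : (Fin 4 → ℝ) →ₗ[ℝ] MvPolynomial (Fin 4) ℝ :=
  Fintype.linearCombination ℝ (fun i => (X i : MvPolynomial (Fin 4) ℝ))

lemma linForm_apply (u : Fin 4 → ℝ) : linForm u = ∑ i, u i • X i := by
  simp [linForm, Fintype.linearCombination_apply]

lemma linForm_single (i : Fin 4) : linForm (Pi.single i 1) = X i := by
  simp [linForm]

lemma linForm_homog (u : Fin 4 → ℝ) : (linForm u).IsHomogeneous 1 := by
  rw [← mem_homogeneousSubmodule, linForm_apply]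
  exact Submodule.sum_mem _ fun i _ => Submodule.smul_mem _ _ (isHomogeneous_X ℝ i)

/-- The product of two linear forms. -/
def prodLin : (Fin 4 → ℝ) →ₗ[ℝ] (Fin 4 → ℝ) →ₗ[ℝ] homogeneousSubmodule (Fin 4) ℝ 2 :=
  LinearMap.mk₂ ℝ (fun p q => ⟨linForm p * linForm q, (linForm_homog p).mul (linForm_homog q)⟩)
    (fun p p' q => Subtype.ext (by simp [add_mul]))
    (fun c p q => Subtype.ext (by simp))
    (fun p q q' => Subtype.ext (by simp [mul_add]))
    (fun c p q => Subtype.ext (by simp))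

lemma prodLin_coe (p q : Fin 4 → ℝ) : (prodLin p q : MvPolynomial (Fin 4) ℝ) = linForm p * linForm q := rfl

/-- The product of two quadratic forms. -/
def prodQuad : homogeneousSubmodule (Fin 4) ℝ 2 →ₗ[ℝ] homogeneousSubmodule (Fin 4) ℝ 2 →ₗ[ℝ]
    homogeneousSubmodule (Fin 4) ℝ 4 :=
  LinearMap.mk₂ ℝ (fun p q => ⟨(p : MvPolynomial (Fin 4) ℝ) * q, IsHomogeneous.mul p.2 q.2⟩)
    (fun p p' q => Subtype.ext (by simp [add_mul]))
    (fun c p q => Subtype.ext (by simp))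
    (fun p q q' => Subtype.ext (by simp [mul_add]))
    (fun c p q => Subtype.ext (by simp))

lemma prodQuad_coe (p q : homogeneousSubmodule (Fin 4) ℝ 2) :
    (prodQuad p q : MvPolynomial (Fin 4) ℝ) = (p : MvPolynomial (Fin 4) ℝ) * q := rfl

lemma span_prodLin (N : Submodule ℝ (homogeneousSubmodule (Fin 4) ℝ 2))
    (h : ∀ i j, prodLin (Pi.single i 1) (Pi.single j 1) ∈ N) : N = ⊤ := by
  rw [eq_top_iff]
  rintro ⟨p, hp⟩ -
  have h1 : p ∈ N.map (homogeneousSubmodule (Fin 4) ℝ 2).subtype := by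
    refine homog_mem 2 _ ?_ p hp
    intro d hd
    obtain ⟨d1, d2, h1, h2, rfl⟩ := mono_split 1 1 d hd
    have hr : ∀ d : Fin 4 →₀ ℕ, d.degree = 1 → ∃ i, Finsupp.single i 1 = d := by
      intro d hd
      have : d ∈ {d : Fin 4 →₀ ℕ | d.degree = 1} := hd
      rw [← Finsupp.range_single_one] at this
      exact this
    obtain ⟨i, rfl⟩ := hr d1 h1
    obtain ⟨j, rfl⟩ := hr d2 h2
    refine ⟨_, h i j, ?_⟩
    rw [Submodule.subtype_apply, prodLin_coe, linForm_single, linForm_single, X, X, monomial_mul, mul_one]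
  obtain ⟨x, hx, hxp⟩ := h1
  have : x = ⟨p, hp⟩ := Subtype.ext hxp
  exact this ▸ hx

lemma span_prodQuad (N : Submodule ℝ (homogeneousSubmodule (Fin 4) ℝ 4))
    (h : ∀ p q, prodQuad p q ∈ N) : N = ⊤ := by
  rw [eq_top_iff]
  rintro ⟨p, hp⟩ -
  have h1 : p ∈ N.map (homogeneousSubmodule (Fin 4) ℝ 4).subtype := by
    refine homog_mem 4 _ ?_ p hp
    intro d hd
    obtain ⟨d1, d2, h1, h2, rfl⟩ := mono_split 2 2 d hd
    refine ⟨_, h ⟨monomial d1 1, isHomogeneous_monomial _ h1⟩ ⟨monomial d2 1, isHomogeneous_monomial _ h2⟩, ?_⟩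
    rw [Submodule.subtype_apply, prodQuad_coe, monomial_mul, mul_one]
  obtain ⟨x, hx, hxp⟩ := h1
  have : x = ⟨p, hp⟩ := Subtype.ext hxp
  exact this ▸ hx

lemma finrank_quad : Module.finrank ℝ (homogeneousSubmodule (Fin 4) ℝ 2) ≤ 10 := by
  let g : {x : Fin 4 × Fin 4 // x.1 ≤ x.2} → homogeneousSubmodule (Fin 4) ℝ 2 :=
    fun x => prodLin (Pi.single x.1.1 1) (Pi.single x.1.2 1)
  have h1 : Submodule.span ℝ (Set.range g) = ⊤ := by
    apply span_prodLin
    intro i j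
    rcases le_total i j with hij | hij
    · exact Submodule.subset_span ⟨⟨(i, j), hij⟩, rfl⟩
    · refine Submodule.subset_span ⟨⟨(j, i), hij⟩, ?_⟩
      apply Subtype.ext
      simp only [g, prodLin_coe]
      rw [mul_comm]
  have h2 := finrank_range_le_card (R := ℝ) g
  rw [Set.finrank, h1, finrank_top] at h2
  exact h2

lemma inSigma_add {f g : MvPolynomial (Fin 4) ℝ} (hf : InSigma 4 2 f) (hg : InSigma 4 2 g) :
    InSigma 4 2 (f + g) := by
  obtain ⟨r, p, hp, rfl⟩ := hf
  obtain ⟨s, q, hq, rfl⟩ := hg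
  refine ⟨r + s, Fin.append p q, ?_, ?_⟩
  · intro i
    refine Fin.addCases (fun i => ?_) (fun i => ?_) i
    · rw [Fin.append_left]; exact hp i
    · rw [Fin.append_right]; exact hq i
  · rw [Fin.sum_univ_add]
    simp only [Fin.append_left, Fin.append_right]

lemma inSigma_smul {f : MvPolynomial (Fin 4) ℝ} (hf : InSigma 4 2 f) (c : ℝ) (hc : 0 ≤ c) :
    InSigma 4 2 (c • f) := by
  obtain ⟨r, p, hp, rfl⟩ := hf
  refine ⟨r, fun i => Real.sqrt c • p i, fun i => ?_, ?_⟩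
  · exact Submodule.smul_mem (homogeneousSubmodule (Fin 4) ℝ 2) _ (hp i)
  · simp only [smul_pow, Real.sq_sqrt hc, Finset.smul_sum]

lemma inSigma_sq {p : MvPolynomial (Fin 4) ℝ} (hp : p.IsHomogeneous 2) : InSigma 4 2 (p * p) :=
  ⟨1, fun _ => p, fun _ => hp, by simp [sq]⟩

/-- Coefficient map. -/
def coeffLin : MvPolynomial (Fin 4) ℝ →ₗ[ℝ] ((Fin 4 →₀ ℕ) → ℝ) :=
  LinearMap.pi fun d => lcoeff ℝ d

lemma poly_addGroup : IsTopologicalAddGroup (MvPolynomial (Fin 4) ℝ) :=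
  topologicalAddGroup_induced coeffLin

lemma poly_smul : ContinuousSMul ℝ (MvPolynomial (Fin 4) ℝ) :=
  continuousSMul_induced coeffLin

lemma poly_t2 : T2Space (MvPolynomial (Fin 4) ℝ) :=
  T2Space.of_injective_continuous (f := fun (f : MvPolynomial (Fin 4) ℝ) (m : Fin 4 →₀ ℕ) => coeff m f)
    (fun p q h => MvPolynomial.ext _ _ fun d => congrFun h d) continuous_induced_dom

lemma exists_functional (f : homogeneousSubmodule (Fin 4) ℝ 4)
    (hsos : InSigma 4 2 (f : MvPolynomial (Fin 4) ℝ))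
    (hbd : f ∉ interior {g : homogeneousSubmodule (Fin 4) ℝ 4 |
      InSigma 4 2 (g : MvPolynomial (Fin 4) ℝ)}) :
    ∃ l : homogeneousSubmodule (Fin 4) ℝ 4 →ₗ[ℝ] ℝ, l ≠ 0 ∧
      (∀ g : homogeneousSubmodule (Fin 4) ℝ 4, InSigma 4 2 (g : MvPolynomial (Fin 4) ℝ) → 0 ≤ l g) ∧ l f = 0 := by
  have := poly_addGroup
  have := poly_smul
  have := poly_t2
  have := finDim_homog 4
  refine exists_supporting {g : homogeneousSubmodule (Fin 4) ℝ 4 | InSigma 4 2 (g : MvPolynomial (Fin 4) ℝ)}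
    ?_ ?_ ?_ ?_ f hsos hbd
  · intro x hx y hy a b ha hb _
    exact inSigma_add (inSigma_smul hx a ha) (inSigma_smul hy b hb)
  · exact ⟨0, Fin.elim0, fun i => i.elim0, by simp⟩
  · apply span_prodQuad
    intro p q
    have hsq : ∀ r : homogeneousSubmodule (Fin 4) ℝ 2, prodQuad r r ∈ Submodule.span ℝ
        {g : homogeneousSubmodule (Fin 4) ℝ 4 | InSigma 4 2 (g : MvPolynomial (Fin 4) ℝ)} :=
      fun r => Submodule.subset_span (inSigma_sq r.2)
    have h1 : prodQuad p q = (4 : ℝ)⁻¹ • (prodQuad (p + q) (p + q) - prodQuad (p - q) (p - q)) := by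
      have hc : prodQuad q p = prodQuad p q := Subtype.ext (mul_comm _ _)
      simp only [map_add, map_sub, LinearMap.add_apply, LinearMap.sub_apply, hc]
      module
    rw [h1]
    exact Submodule.smul_mem _ _ (Submodule.sub_mem _ (hsq _) (hsq _))
  · intro x hx
    exact inSigma_smul hx 2 (by norm_num)

/-- Blekherman's theorem, case `(4,4)`: every positive definite quaternary
quartic in the boundary of the cone `Σ_{4,4}` is a sum of four squares of
quadratic forms. -/
theorem boundary_posdef_four_squares
    (f : MvPolynomial.homogeneousSubmodule (Fin 4) ℝ 4)
    (hsos : InSigma 4 2 (f : MvPolynomial (Fin 4) ℝ))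
    (hpos : ∀ x : Fin 4 → ℝ, x ≠ 0 → 0 < eval x (f : MvPolynomial (Fin 4) ℝ))
    (hbd : f ∉ interior {g : MvPolynomial.homogeneousSubmodule (Fin 4) ℝ 4 |
      InSigma 4 2 (g : MvPolynomial (Fin 4) ℝ)}) :
    IsSOS 4 2 4 (f : MvPolynomial (Fin 4) ℝ) := by
  classical
  obtain ⟨l, hl0, hlpos, hlf⟩ := exists_functional f hsos hbd
  have hfd2 := finDim_homog 2
  let Q : homogeneousSubmodule (Fin 4) ℝ 2 →ₗ[ℝ] homogeneousSubmodule (Fin 4) ℝ 2 →ₗ[ℝ] ℝ := prodQuad.compr₂ l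
  have hQ : ∀ p q, Q p q = l (prodQuad p q) := fun p q => rfl
  obtain ⟨n, S, hS⟩ := exists_factor Q
    (fun p q => by rw [hQ, hQ]; exact congrArg l (Subtype.ext (mul_comm _ _)))
    (fun p => hlpos _ (inSigma_sq p.2))
  have hS0 : ∀ p, Q p p = 0 → S p = 0 := by
    intro p hp
    rw [hS] at hp
    exact inner_self_eq_zero.mp hp
  obtain ⟨r, g, hg, hfg⟩ := hsos
  let g' : Fin r → homogeneousSubmodule (Fin 4) ℝ 2 := fun i => ⟨g i, hg i⟩
  have hfsum : f = ∑ i, prodQuad (g' i) (g' i) := by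
    apply Subtype.ext
    rw [hfg, Submodule.coe_sum]
    exact Finset.sum_congr rfl fun i _ => sq (g i)
  have hgker : ∀ i, S (g' i) = 0 := by
    rw [hfsum, map_sum] at hlf
    intro i
    refine hS0 _ ((Finset.sum_eq_zero_iff_of_nonneg (fun i _ => ?_)).mp hlf i (Finset.mem_univ _))
    exact hlpos _ (inSigma_sq (g' i).2)
  by_cases hdim : Module.finrank ℝ (LinearMap.ker S) ≤ 4
  · let W : Submodule ℝ (MvPolynomial (Fin 4) ℝ) :=
      (LinearMap.ker S).map (homogeneousSubmodule (Fin 4) ℝ 2).subtype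
    have hWf : Module.finrank ℝ W = Module.finrank ℝ (LinearMap.ker S) :=
      ((LinearMap.ker S).equivMapOfInjective _ (Submodule.subtype_injective _)).finrank_eq.symm
    obtain ⟨h, hh, hsum⟩ := four_squares_of_finrank W (by omega) g (fun i => ⟨g' i, hgker i, rfl⟩)
    refine ⟨h, ?_, hfg.trans hsum⟩
    intro i
    obtain ⟨x, _, hx⟩ := hh i
    rw [← hx]
    exact x.2
  · exfalso
    have hrn := LinearMap.finrank_range_add_finrank_ker S
    have h10 := finrank_quad
    let m : (Fin 4 → ℝ) →ₗ[ℝ] (Fin 4 → ℝ) →ₗ[ℝ] LinearMap.range S := prodLin.compr₂ S.rangeRestrict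
    have hm : ∀ p q, (m p q : EuclideanSpace ℝ (Fin n)) = S (prodLin p q) := fun p q => rfl
    have hSne : 0 < Module.finrank ℝ (LinearMap.range S) := by
      by_contra hcon
      have h1 : LinearMap.range S = ⊥ := Submodule.finrank_eq_zero.mp (by omega)
      have h2 : S = 0 := LinearMap.range_eq_bot.mp h1
      apply hl0
      have h3 : LinearMap.ker l = ⊤ := by
        apply span_prodQuad
        intro p q
        rw [LinearMap.mem_ker, ← hQ, hS, h2]
        simp
      exact LinearMap.ker_eq_top.mp h3
    obtain ⟨y, v, hy0, hy⟩ := exists_point m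
      (fun p q => Subtype.ext (by
        rw [hm, hm]; exact congrArg S (Subtype.ext (mul_comm _ _))))
      (fun p q r s => by
        rw [Submodule.coe_inner, Submodule.coe_inner, hm, hm, hm, hm, ← hS, ← hS, hQ, hQ]
        refine congrArg l (Subtype.ext ?_)
        simp only [prodQuad_coe, prodLin_coe]
        ring)
      (by
        intro N hN
        have h1 : N.comap S.rangeRestrict = ⊤ := span_prodLin _ fun i j => hN _ _
        rw [eq_top_iff]
        rintro ⟨_, x, rfl⟩ -
        have h2 : x ∈ N.comap S.rangeRestrict := by rw [h1]; trivial
        exact h2)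
      (by simp) (by omega) hSne
    let pt : Fin 4 → ℝ := fun i => y (Pi.single i 1)
    have hpt : pt ≠ 0 := by
      intro h
      apply hy0
      refine LinearMap.pi_ext' fun i => ?_
      ext
      exact congrFun h i
    let ev : homogeneousSubmodule (Fin 4) ℝ 2 →ₗ[ℝ] ℝ :=
      (aeval pt).toLinearMap ∘ₗ (homogeneousSubmodule (Fin 4) ℝ 2).subtype
    have hev : ∀ p, ev p = eval pt (p : MvPolynomial (Fin 4) ℝ) := by
      intro p
      simp [ev, aeval_eq_eval]
    let psi : homogeneousSubmodule (Fin 4) ℝ 2 →ₗ[ℝ] ℝ := (innerₛₗ ℝ v) ∘ₗ S.rangeRestrict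
    have hpsi : ∀ p, psi p = inner ℝ v (S.rangeRestrict p) := fun p => rfl
    have hker : LinearMap.eqLocus psi ev = ⊤ := by
      apply span_prodLin
      intro i j
      rw [LinearMap.mem_eqLocus, hev, prodLin_coe, linForm_single, linForm_single, hpsi, real_inner_comm]
      simp only [map_mul, eval_X]
      exact hy _ _
    have hgz : ∀ i, eval pt (g i) = 0 := by
      intro i
      have h1 : g' i ∈ LinearMap.eqLocus psi ev := by rw [hker]; trivial
      have h2 : psi (g' i) = ev (g' i) := h1
      have h3 : S.rangeRestrict (g' i) = 0 := Subtype.ext (hgker i)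
      rw [hev, hpsi, h3, inner_zero_right] at h2
      exact h2.symm
    have := hpos pt hpt
    rw [hfg, map_sum] at this
    simp [hgz] at this
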